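/- arXiv:2402.19234 — 2 statements merged into one kernel-verified Lean document; each statement's English description precedes it below -/
import Mathlib

section
/- Let n = qa with 3 ≤ q < a-1 and a = kq + 1 + s with k ≥ 1 and 0 ≤ s ≤ q-1. Then the broadcast independence number of C⃗(n;1,a) is at least a(q-1) when s = 0, at least (a-1)(q-1)+1 when s = 1, and at least (a-s)(q-1)+s(s-1) when s ≥ 2. -/
/-- Arc relation of the oriented circulant graph C⃗(n;1,a): arcs u → u+1 and u → u+a (mod n). -/
def circArc (n : ℕ) (a : ℤ) (u v : ZMod n) : Prop :=
  v = u + 1 ∨ v = u + (a : ZMod n)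

/-- There is a directed walk of length k from u to v in C⃗(n;1,a). -/
def circSteps (n : ℕ) (a : ℤ) (u v : ZMod n) (k : ℕ) : Prop :=
  ∃ g : ℕ → ZMod n, g 0 = u ∧ g k = v ∧ ∀ i < k, circArc n a (g i) (g (i + 1))

/-- Directed distance: length of a shortest directed path from u to v. -/
noncomputable def circDist (n : ℕ) (a : ℤ) (u v : ZMod n) : ℕ :=
  sInf {k | circSteps n a u v k}

/-- Eccentricity of a vertex: maximum distance from it to any vertex. -/
noncomputable def circEcc (n : ℕ) (a : ℤ) (u : ZMod n) : ℕ :=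
  sSup {d | ∃ v, d = circDist n a u v}

/-- Diameter: maximum eccentricity. -/
noncomputable def circDiam (n : ℕ) (a : ℤ) : ℕ :=
  sSup {d | ∃ u, d = circEcc n a u}

/-- f is an independent broadcast on C⃗(n;1,a). -/
def IsIndepBroadcast (n : ℕ) (a : ℤ) (f : ZMod n → ℕ) : Prop :=
  (∀ v, f v ≤ circEcc n a v) ∧
  ∀ u v : ZMod n, u ≠ v → 0 < f u → 0 < f v → f u < circDist n a u v

/-- Cost of a broadcast: sum of its values over all vertices. -/
def circCost (n : ℕ) (f : ZMod n → ℕ) : ℕ :=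
  ∑ i ∈ Finset.range n, f (i : ZMod n)

/-- The broadcast independence number of C⃗(n;1,a). -/
noncomputable def betaB (n : ℕ) (a : ℤ) : ℕ :=
  sSup {c | ∃ f : ZMod n → ℕ, IsIndepBroadcast n a f ∧ c = circCost n f}

lemma steps_repr (n a : ℕ) (u : ZMod n) (m : ℕ) : ∀ v, circSteps n (a : ℤ) u v m →
    ∃ i j : ℕ, i + j = m ∧ v = u + ((i + j * a : ℕ) : ZMod n) := by
  induction m with
  | zero =>
    rintro v ⟨g, h0, h1, -⟩
    exact ⟨0, 0, rfl, by simp [← h0, ← h1]⟩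
  | succ m ih =>
    rintro v ⟨g, h0, h1, h2⟩
    obtain ⟨i, j, hij, hv⟩ := ih (g m) ⟨g, h0, rfl, fun i hi => h2 i (by omega)⟩
    rcases h2 m (by omega) with h | h
    · refine ⟨i + 1, j, by omega, ?_⟩
      rw [← h1, h, hv]; push_cast; ring
    · refine ⟨i, j + 1, by omega, ?_⟩
      rw [← h1, h, hv]; push_cast; ring

lemma steps_dist (n a : ℕ) [NeZero n] (u v : ZMod n) :
    circSteps n (a : ℤ) u v (circDist n (a : ℤ) u v) := by
  have : {k | circSteps n (a : ℤ) u v k}.Nonempty := by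
    refine ⟨(v - u).val, fun i => u + (i : ZMod n), by simp, by simp, ?_⟩
    intro i _
    left
    push_cast; ring
  exact Nat.sInf_mem this

lemma dist_repr (n a : ℕ) [NeZero n] (u v : ZMod n) :
    ∃ i j : ℕ, i + j = circDist n (a : ℤ) u v ∧ v = u + ((i + j * a : ℕ) : ZMod n) :=
  steps_repr n a u _ v (steps_dist n a u v)

lemma dist_le_ecc (n : ℕ) (a : ℤ) [NeZero n] (u v : ZMod n) :
    circDist n a u v ≤ circEcc n a u := by
  apply le_csSup
  · have : {d | ∃ v, d = circDist n a u v} = Set.range (circDist n a u) := by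
      ext d; simp [eq_comm]
    rw [this]
    exact (Set.finite_range _).bddAbove
  · exact ⟨v, rfl⟩

lemma cost_le_beta (n : ℕ) (a : ℤ) (f : ZMod n → ℕ) (hf : IsIndepBroadcast n a f) :
    circCost n f ≤ betaB n a := by
  apply le_csSup
  · refine ⟨circCost n (circEcc n a), ?_⟩
    rintro c ⟨f, hf, rfl⟩
    exact Finset.sum_le_sum fun i _ => hf.1 _
  · exact ⟨f, hf, rfl⟩

lemma ecc_ge (n a q : ℕ) [NeZero n] (hn : n = q * a) (u : ZMod n) :
    a - 1 ≤ circEcc n (a : ℤ) u := by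
  refine le_trans ?_ (dist_le_ecc n a u (u - 1))
  obtain ⟨i, j, hij, h⟩ := dist_repr n a u (u - 1)
  rw [← hij]
  have h2 : ((i + j * a + 1 : ℕ) : ZMod n) = 0 := by
    push_cast at h ⊢
    linear_combination -h
  rw [ZMod.natCast_eq_zero_iff] at h2
  have h3 : a ∣ i + j * a + 1 := (Dvd.intro_left q hn.symm).trans h2
  have h4 : a ∣ i + 1 := by
    have : i + j * a + 1 = (i + 1) + a * j := by ring
    rw [this] at h3
    exact (Nat.dvd_add_left (Dvd.intro j rfl)).1 h3
  have := Nat.le_of_dvd (by omega) h4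
  omega

/-- Arithmetic core. -/
lemma core (a q k s x y x' y' i j : ℕ) (ha : a = k * q + 1 + s)
    (hx' : x' < a) (hxy : q ∣ y + x) (hxy' : q ∣ y' + x') (ha0 : 0 < a)
    (h : x' + y' * a ≡ x + y * a + (i + j * a) [MOD (q * a)]) :
    ∃ t, x + i = x' + t * a ∧ i + j ≡ t * s [MOD q] := by
  have h1 : x' ≡ x + i [MOD a] := by
    have h2 := Nat.ModEq.of_mul_left q h
    have e : x + y * a + (i + j * a) = (x + i) + a * (y + j) := by ring
    have e' : x' + y' * a = x' + a * y' := by ring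
    rw [e, e'] at h2
    unfold Nat.ModEq at *
    simpa using h2
  have h2 : x + i = x' + ((x + i) / a) * a := by
    have := Nat.mod_add_div (x + i) a
    rw [← h1, Nat.mod_eq_of_lt hx'] at this
    linarith
  generalize (x + i) / a = t at h2
  refine ⟨t, h2, ?_⟩
  have e : x + y * a + (i + j * a) = x' + (t + y + j) * a := by
    linear_combination h2
  rw [e] at h
  have h3 : y' * a ≡ (t + y + j) * a [MOD q * a] := Nat.ModEq.add_left_cancel' _ h
  have h4 : y' ≡ t + y + j [MOD q] := Nat.ModEq.mul_right_cancel' (by omega) h3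
  rw [← Int.natCast_modEq_iff, Int.modEq_iff_dvd] at h4 ⊢
  obtain ⟨c, hc⟩ := h4
  obtain ⟨d, hd⟩ := hxy
  obtain ⟨e, he⟩ := hxy'
  refine ⟨-c + d - e - t * k, ?_⟩
  zify at h2 hd he ha
  push_cast at hc ⊢
  rw [ha] at h2
  linear_combination -hc - h2 + hd - he

lemma main_bound (n a q k s : ℕ) (hn : n = q * a) (hq : 3 ≤ q) (hqa : q < a - 1)
    (ha : a = k * q + 1 + s) (g : ℕ → ℕ) (hg : ∀ x, g x ≤ q)
    (H1 : ∀ x x', x < x' → x' < a → 0 < g x → 0 < g x' → g x < q)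
    (H2 : ∀ x x' m, x' < x → x < a → 0 < g x → 0 < g x' → a ≤ m + x →
      m % q = s % q → a - (x - x') ≤ m → g x < m) :
    ∑ x ∈ Finset.range a, g x ≤ betaB n (a : ℤ) := by
  have hn0 : 0 < n := by rw [hn]; exact Nat.mul_pos (by omega) (by omega)
  have : NeZero n := ⟨hn0.ne'⟩
  have ha0 : 0 < a := by omega
  set F : ℕ → ℕ := fun w => if q ∣ w / a + w % a then g (w % a) else 0 with hF
  have hFpos : ∀ w, 0 < F w → q ∣ w / a + w % a ∧ F w = g (w % a) := by
    intro w hw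
    simp only [hF] at hw ⊢
    split_ifs at hw ⊢ with h
    · exact ⟨h, rfl⟩
    · omega
  refine le_trans ?_ (cost_le_beta n a (fun v => F v.val) ⟨?_, ?_⟩)
  · unfold circCost
    set φ : ℕ → ℕ := fun x => x + ((q - x % q) % q) * a with hφ
    have hdiv : ∀ x < a, φ x / a = (q - x % q) % q := by
      intro x hx
      simp only [hφ]
      rw [Nat.add_mul_div_right _ _ ha0, Nat.div_eq_of_lt hx, zero_add]
    have hmod : ∀ x < a, φ x % a = x := by
      intro x hx
      simp only [hφ]
      rw [Nat.add_mul_mod_self_right, Nat.mod_eq_of_lt hx]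
    have hlt : ∀ x < a, φ x < n := by
      intro x hx
      have : (q - x % q) % q + 1 ≤ q := Nat.mod_lt _ (by omega)
      have := Nat.mul_le_mul_right a this
      simp only [hφ]
      rw [hn]
      linarith
    have hinj : Set.InjOn φ (Finset.range a : Set ℕ) := by
      intro x hx x' hx' h
      simp only [Finset.coe_range, Set.mem_Iio] at hx hx'
      rw [← hmod x hx, h, hmod x' hx']
    calc ∑ x ∈ Finset.range a, g x
        = ∑ x ∈ Finset.range a, F ((φ x : ℕ) : ZMod n).val := by
          refine Finset.sum_congr rfl fun x hx => ?_
          rw [Finset.mem_range] at hx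
          rw [ZMod.val_cast_of_lt (hlt x hx)]
          simp only [hF]
          rw [hdiv x hx, hmod x hx, if_pos]
          apply Nat.dvd_of_mod_eq_zero
          have h1 : x % q < q := Nat.mod_lt _ (by omega)
          rw [Nat.add_mod, Nat.mod_mod, ← Nat.add_mod]
          have : q - x % q + x = q * (1 + x / q) := by
            have := Nat.mod_add_div x q
            rw [mul_add]
            omega
          rw [this, Nat.mul_mod_right]
      _ = ∑ w ∈ (Finset.range a).image φ, F ((w : ℕ) : ZMod n).val :=
          (Finset.sum_image (f := fun w : ℕ => F ((w : ℕ) : ZMod n).val) hinj).symm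
      _ ≤ _ := by
          apply Finset.sum_le_sum_of_subset
          intro w hw
          simp only [Finset.mem_image, Finset.mem_range] at hw ⊢
          obtain ⟨x, hx, rfl⟩ := hw
          exact hlt x hx
  · intro v
    refine le_trans ?_ (ecc_ge n a q hn v)
    have : F v.val ≤ q := by
      simp only [hF]
      split_ifs
      · exact hg _
      · omega
    show F v.val ≤ a - 1
    omega
  · intro u v huv hu hv
    show F u.val < _
    obtain ⟨hu1, hu2⟩ := hFpos _ hu
    obtain ⟨hv1, hv2⟩ := hFpos _ hv
    change 0 < F u.val at hu
    change 0 < F v.val at hv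
    rw [hu2] at hu ⊢
    rw [hv2] at hv
    obtain ⟨i, j, hij, h⟩ := dist_repr n a u v
    rw [← hij]
    have hul := ZMod.val_lt u
    have hvl := ZMod.val_lt v
    have huv' : u.val ≠ v.val := fun h => huv (ZMod.val_injective n h)
    have hc : v.val ≡ u.val + (i + j * a) [MOD q * a] := by
      rw [← hn, ← ZMod.natCast_eq_natCast_iff]
      simpa using h
    generalize u.val = U at *
    generalize v.val = V at *
    have hxU := Nat.mod_lt U ha0
    have hxV := Nat.mod_lt V ha0
    have eU : U = U % a + U / a * a := by rw [mul_comm]; exact (Nat.mod_add_div U a).symm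
    have eV : V = V % a + V / a * a := by rw [mul_comm]; exact (Nat.mod_add_div V a).symm
    have hyU : U / a < q := by rw [Nat.div_lt_iff_lt_mul ha0, ← hn]; exact hul
    have hyV : V / a < q := by rw [Nat.div_lt_iff_lt_mul ha0, ← hn]; exact hvl
    generalize U % a = x at *
    generalize V % a = x' at *
    generalize U / a = y at *
    generalize V / a = y' at *
    rw [eU, eV] at hc
    obtain ⟨t, ht, hm⟩ := core a q k s x y x' y' i j ha hxV hu1 hv1 ha0 hc
    have hgx := hg x
    rcases lt_trichotomy x x' with hlt | heq | hgt
    · have := H1 x x' hlt hxV hu hv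
      rcases Nat.eq_zero_or_pos t with rfl | htp
      · have hd : q ∣ i + j := by
          rw [zero_mul] at hm
          exact (Nat.modEq_zero_iff_dvd).1 hm
        have := Nat.le_of_dvd (by omega) hd
        omega
      · have : a ≤ t * a := Nat.le_mul_of_pos_left a htp
        omega
    · exfalso
      apply huv'
      subst heq
      have : y + x ≡ y' + x [MOD q] :=
        ((Nat.modEq_zero_iff_dvd).2 hu1).trans ((Nat.modEq_zero_iff_dvd).2 hv1).symm
      have := Nat.ModEq.add_right_cancel' _ this
      have := Nat.ModEq.eq_of_lt_of_lt this hyU hyV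
      rw [eU, eV, this]
    · have ht0 : t ≠ 0 := by
        rintro rfl
        omega
      rcases Nat.lt_or_ge t 2 with h2 | h2
      · have : t = 1 := by omega
        subst this
        rw [one_mul] at hm ht
        exact H2 x x' _ hgt hxU hu hv (by omega) hm (by omega)
      · have : 2 * a ≤ t * a := Nat.mul_le_mul_right a h2
        omega

lemma mod_ge (m q s : ℕ) (h : m % q = s) (hlt : s < m) : q + s ≤ m := by
  have h1 := Nat.mod_add_div m q
  rcases Nat.eq_zero_or_pos (m / q) with h0 | h0
  · rw [h0] at h1; omega
  · have := Nat.le_mul_of_pos_right q h0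
    omega

lemma case_ne (n a q k s : ℕ) (hn : n = q * a) (hq : 3 ≤ q) (hqa : q < a - 1)
    (ha : a = k * q + 1 + s) (hs : s ≤ q - 1) :
    (a - s) * (q - 1) + s * (s - 1) ≤ betaB n (a : ℤ) := by
  refine le_trans (le_of_eq ?_) (main_bound n a q k s hn hq hqa ha
    (fun x => if x < a - s then q - 1 else s - 1) ?_ ?_ ?_)
  · have e : a = (a - s) + s := by omega
    generalize a - s = b at *
    subst e
    rw [Finset.sum_range_add]
    congr 1
    · rw [Finset.sum_congr rfl (g := fun _ => q - 1)]
      · simp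
      · intro x hx
        rw [Finset.mem_range] at hx
        simp [hx]
    · simp
  · intro x; split_ifs <;> omega
  · intro x x' _ _ _ _; split_ifs <;> omega
  · intro x x' m h1 h2 h3 h4 h5 h6 h7
    rw [Nat.mod_eq_of_lt (show s < q by omega)] at h6
    have := Nat.mod_le m q
    split_ifs at h3 ⊢ with h
    · have := mod_ge m q s h6 (by omega)
      omega
    · omega

lemma case_one (n a q k s : ℕ) (hn : n = q * a) (hq : 3 ≤ q) (hqa : q < a - 1)
    (ha : a = k * q + 1 + s) (hs : s = 1) :
    (a - 1) * (q - 1) + 1 ≤ betaB n (a : ℤ) := by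
  refine le_trans (le_of_eq ?_) (main_bound n a q k s hn hq hqa ha
    (fun x => if x < a - 2 then q - 1 else if x = a - 2 then q else 0) ?_ ?_ ?_)
  · clear ha
    obtain ⟨b, rfl⟩ : ∃ b, a = b + 2 := ⟨a - 2, by omega⟩
    rw [Finset.sum_range_succ, Finset.sum_range_succ,
      Finset.sum_congr rfl (g := fun _ => q - 1)]
    · obtain ⟨r, rfl⟩ : ∃ r, q = r + 1 := ⟨q - 1, by omega⟩
      simp
      ring
    · intro x hx
      rw [Finset.mem_range] at hx
      simp [hx]
  · intro x; split_ifs <;> omega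
  · intro x x' _ _ h h'; split_ifs at h h' ⊢ <;> omega
  · intro x x' m h1 h2 h3 h4 h5 h6 h7
    rw [Nat.mod_eq_of_lt (show s < q by omega)] at h6
    have : x ≤ a - 2 := by
      by_contra hh
      rw [if_neg (by omega), if_neg (by omega)] at h3
      omega
    have := mod_ge m q s h6 (by omega)
    split_ifs <;> omega

theorem stmt16 (n a q k s : ℕ) (hn : n = q * a) (hq : 3 ≤ q) (hqa : q < a - 1)
    (ha : a = k * q + 1 + s) (hk : 1 ≤ k) (hs : s ≤ q - 1) :
    (s = 0 → a * (q - 1) ≤ betaB n (a : ℤ)) ∧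
    (s = 1 → (a - 1) * (q - 1) + 1 ≤ betaB n (a : ℤ)) ∧
    (2 ≤ s → (a - s) * (q - 1) + s * (s - 1) ≤ betaB n (a : ℤ)) := by
  refine ⟨fun h => ?_, fun h => case_one n a q k s hn hq hqa ha h,
    fun _ => case_ne n a q k s hn hq hqa ha hs⟩
  have := case_ne n a q k s hn hq hqa ha hs
  subst h
  simpa using this
end

section
/- Let n = qa + a - 1 with q ≥ 3 and a ≥ 4. If a = kq + 1 for some integer k ≥ 2, then the broadcast independence number of C⃗(n;1,a) equals (a+k)(q-1). If instead q = k(a-1) for some integer k ≥ 1, then the broadcast independence number of C⃗(n;1,a) equals (q+k+1)(a-2). -/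
/-- Size of the interval covered by a broadcast value `r`. -/
def covW (q r : ℕ) : ℕ :=
  if r = 0 then 0 else if r < q then r + 1 else (r - q + 2) * (q + 1) - 1

lemma steps_refl (n : ℕ) (a : ℤ) (u : ZMod n) : circSteps n a u u 0 :=
  ⟨fun _ => u, rfl, rfl, by simp⟩

lemma steps_succ {n : ℕ} {a : ℤ} {u v w : ZMod n} {k : ℕ} (h : circSteps n a u v k)
    (hw : circArc n a v w) : circSteps n a u w (k + 1) := by
  obtain ⟨g, h0, hk, hs⟩ := h
  refine ⟨fun i => if i ≤ k then g i else w, by simpa using h0, by simp, ?_⟩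
  intro i hi
  rcases Nat.lt_succ_iff_lt_or_eq.mp hi with hi | rfl
  · have h1 : i ≤ k := by omega
    have h2 : i + 1 ≤ k := by omega
    simpa [h1, h2] using hs i hi
  · simpa [hk] using hw

lemma steps_lin {n : ℕ} {a : ℤ} {g h : ZMod n} (hg : ∀ u, circArc n a u (u + g))
    (hh : ∀ u, circArc n a u (u + h)) (u : ZMod n) (i j : ℕ) :
    circSteps n a u (u + i * h + j * g) (i + j) := by
  have h1 : circSteps n a u (u + i * h) i := by
    induction i with
    | zero => simpa using steps_refl n a u
    | succ i ih =>
      have := steps_succ ih (hh _)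
      convert this using 1
      push_cast; ring
  induction j with
  | zero => simpa using h1
  | succ j ih =>
    have := steps_succ ih (hg _)
    rw [add_assoc i j 1] at this
    convert this using 1
    push_cast; ring

lemma steps_cast {n q : ℕ} {a : ℤ} (hqn : q ∣ n) (haq : (a : ZMod q) = 1) {u v : ZMod n} {k : ℕ}
    (h : circSteps n a u v k) :
    ZMod.castHom hqn (ZMod q) v = ZMod.castHom hqn (ZMod q) u + k := by
  obtain ⟨g, h0, hk, hs⟩ := h
  have key : ∀ i ≤ k, ZMod.castHom hqn (ZMod q) (g i) = ZMod.castHom hqn (ZMod q) u + i := by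
    intro i
    induction i with
    | zero => intro _; simp [h0]
    | succ i ih =>
      intro hi
      have e := ih (by omega)
      rcases hs i (by omega) with h | h
      · rw [h, map_add, e, map_one]; push_cast; ring
      · rw [h, map_add, e, map_intCast, haq]; push_cast; ring
  rw [← hk]; exact key k le_rfl

lemma covW_spec {q r t : ℕ} (hq : 3 ≤ q) (ht : t < covW q r) :
    t / (q + 1) + t % (q + 1) ≤ r := by
  unfold covW at ht
  split_ifs at ht with h0 h1
  · omega
  · rw [Nat.div_eq_of_lt (by omega), Nat.mod_eq_of_lt (by omega)]; omega
  · have hm := Nat.mod_lt t (show 0 < q + 1 by omega)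
    have hd := Nat.div_add_mod t (q + 1)
    set i := t / (q + 1)
    set j := t % (q + 1)
    obtain ⟨s, rfl⟩ : ∃ s, r = q + s := ⟨r - q, by omega⟩
    have e : q + s - q = s := by omega
    rw [e] at ht
    by_contra hc
    have : i ≤ s + 1 := by
      by_contra h
      have : (q + 1) * (s + 2) ≤ (q + 1) * i := Nat.mul_le_mul_left _ (by omega)
      have : (q + 1) * (s + 2) = (s + 2) * (q + 1) := by ring
      omega
    have hi : i = s + 1 := by omega
    have hj : j = q := by omega
    rw [hi, hj] at hd
    have : (s + 2) * (q + 1) = (q + 1) * (s + 1) + q + 1 := by ring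
    omega

lemma covW_le {n b q r : ℕ} (hq : 3 ≤ q) (hb : 2 ≤ b) (hn : n + 1 = b * (q + 1))
    (hr : r ≤ b + q - 2) : covW q r ≤ n := by
  unfold covW
  have h2 : 2 * (q + 1) ≤ b * (q + 1) := Nat.mul_le_mul_right _ hb
  split_ifs with h0 h1
  · omega
  · omega
  · have : (r - q + 2) * (q + 1) ≤ b * (q + 1) := Nat.mul_le_mul_right _ (by omega)
    omega

lemma covW_cost {q r : ℕ} (hq : 3 ≤ q) : q * r ≤ (q - 1) * covW q r := by
  obtain ⟨p, rfl⟩ : ∃ p, q = p + 1 := ⟨q - 1, by omega⟩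
  unfold covW
  split_ifs with h0 h1
  · simp [h0]
  · simp only [Nat.add_sub_cancel]; nlinarith
  · obtain ⟨s, rfl⟩ : ∃ s, r = p + 1 + s := ⟨r - (p + 1), by omega⟩
    have e : p + 1 + s - (p + 1) = s := by omega
    have e2 : (s + 2) * (p + 1 + 1) - 1 = s * (p + 2) + 2 * p + 3 := by
      have : (s + 2) * (p + 1 + 1) = s * (p + 2) + 2 * p + 3 + 1 := by ring
      omega
    rw [e, e2, Nat.add_sub_cancel]
    nlinarith [Nat.zero_le (s * p), Nat.zero_le (s * p * p)]

section main
variable {n b q m : ℕ} {a : ℤ} {g h g' : ZMod n}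

lemma dist_le_of (hg : ∀ u, circArc n a u (u + g)) (hh : ∀ u, circArc n a u (u + h))
    (hgh : h = (q + 1 : ℕ) * g) (u : ZMod n) (t : ℕ) :
    circSteps n a u (u + t * g) (t / (q + 1) + t % (q + 1)) := by
  have := steps_lin hg hh u (t / (q + 1)) (t % (q + 1))
  convert this using 1
  have hd := Nat.div_add_mod t (q + 1)
  conv_lhs => rw [← hd]
  rw [hgh]; push_cast; ring

lemma main_lemma (hq : 3 ≤ q) (hb : 2 ≤ b) (hn : n + 1 = b * (q + 1)) (hm : n = q * m)
    (hg : ∀ u, circArc n a u (u + g)) (hh : ∀ u, circArc n a u (u + h))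
    (hgh : h = (q + 1 : ℕ) * g) (hinv : g * g' = 1) (haq : (a : ZMod q) = 1) :
    betaB n a = m * (q - 1) := by
  have h2 : 2 * (q + 1) ≤ b * (q + 1) := Nat.mul_le_mul_right _ hb
  have hn0 : 0 < n := by omega
  haveI : NeZero n := ⟨by omega⟩
  haveI : NeZero q := ⟨by omega⟩
  have hqn : q ∣ n := ⟨m, hm⟩
  -- enumeration
  have henum : ∀ u v : ZMod n, ∃ t < n, v = u + (t : ℕ) * g := by
    intro u v
    refine ⟨((v - u) * g').val, ZMod.val_lt _, ?_⟩
    rw [ZMod.natCast_zmod_val]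
    linear_combination (u - v) * hinv
  have hdist : ∀ u v : ZMod n, circDist n a u v ≤ b + q - 2 := by
    intro u v
    obtain ⟨t, ht, rfl⟩ := henum u v
    have h1 : circDist n a u (u + t * g) ≤ t / (q + 1) + t % (q + 1) :=
      Nat.sInf_le (dist_le_of hg hh hgh u t)
    refine h1.trans (covW_spec hq ?_)
    unfold covW
    rw [if_neg (by omega), if_neg (by omega)]
    have : b + q - 2 - q + 2 = b := by omega
    rw [this]; omega
  have hmem : ∀ u v : ZMod n, circSteps n a u v (circDist n a u v) := by
    intro u v
    obtain ⟨t, ht, rfl⟩ := henum u v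
    exact Nat.sInf_mem (s := {k | circSteps n a u (u + t * g) k}) ⟨_, dist_le_of hg hh hgh u t⟩
  have hecc : ∀ u, circEcc n a u ≤ b + q - 2 := by
    intro u
    refine csSup_le ⟨_, u, rfl⟩ ?_
    rintro d ⟨v, rfl⟩
    exact hdist u v
  have hecc' : ∀ u v, circDist n a u v ≤ circEcc n a u := by
    intro u v
    refine le_csSup ⟨b + q - 2, ?_⟩ ⟨v, rfl⟩
    rintro d ⟨v, rfl⟩
    exact hdist u v
  have hcost : ∀ f : ZMod n → ℕ, circCost n f = ∑ v, f v := by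
    intro f
    unfold circCost
    refine Finset.sum_bij (fun i _ => (i : ZMod n)) (by simp) ?_ ?_ (by simp)
    · intro i hi j hj hij
      have := (ZMod.natCast_eq_natCast_iff' i j n).1 hij
      rwa [Nat.mod_eq_of_lt (by simpa using hi), Nat.mod_eq_of_lt (by simpa using hj)] at this
    · intro v _
      exact ⟨v.val, by simpa using ZMod.val_lt v, by simp⟩
  have hupper : ∀ f, IsIndepBroadcast n a f → circCost n f ≤ m * (q - 1) := by
    rintro f ⟨hf1, hf2⟩
    have hW : ∀ v, covW q (f v) ≤ n := fun v => covW_le hq hb hn ((hf1 v).trans (hecc v))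
    have hpos : ∀ v i, i < covW q (f v) → 0 < f v := by
      intro v i hi
      rcases Nat.eq_zero_or_pos (f v) with h | h
      · rw [h] at hi; simp [covW] at hi
      · exact h
    have sep : ∀ (u v : ZMod n) (i j : ℕ), i < covW q (f u) → j < covW q (f v) →
        u + i * g = v + j * g → j ≤ i → u = v ∧ i = j := by
      intro u v i j hi hj he hij
      have hv : v = u + ((i - j : ℕ) : ZMod n) * g := by
        rw [Nat.cast_sub hij]; linear_combination -he
      by_cases huv : u = v
      · refine ⟨huv, ?_⟩
        have h0 : ((i - j : ℕ) : ZMod n) = 0 := by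
          have : ((i - j : ℕ) : ZMod n) * g = 0 := by
            rw [← huv] at hv; linear_combination -hv
          linear_combination g' * this - ((i - j : ℕ) : ZMod n) * hinv
        rw [ZMod.natCast_eq_zero_iff] at h0
        have := Nat.eq_zero_of_dvd_of_lt h0 (by have := hW u; omega)
        omega
      · exfalso
        have h1 := hf2 u v huv (hpos u i hi) (hpos v j hj)
        have h2 : circDist n a u v ≤ (i - j) / (q + 1) + (i - j) % (q + 1) := by
          apply Nat.sInf_le
          have := dist_le_of hg hh hgh u (i - j)
          rw [← hv] at this
          exact this
        have h3 := covW_spec hq (show i - j < covW q (f u) by omega)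
        omega
    have hsum : ∑ v, covW q (f v) ≤ n := by
      have := Finset.card_le_card_of_injOn
        (s := (Finset.univ : Finset (ZMod n)).sigma fun v => Finset.range (covW q (f v)))
        (t := (Finset.univ : Finset (ZMod n))) (fun x => x.1 + (x.2 : ZMod n) * g)
        (by intro x _; simp) (by
          rintro ⟨u, i⟩ hi ⟨v, j⟩ hj he
          simp at hi hj he
          rcases le_total j i with hij | hij
          · obtain ⟨rfl, rfl⟩ := sep u v i j hi hj he hij
            rfl
          · obtain ⟨rfl, rfl⟩ := sep v u j i hj hi he.symm hij
            rfl)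
      simpa [Finset.card_sigma, ZMod.card] using this
    rw [hcost]
    have h3 : q * ∑ v, f v ≤ q * (m * (q - 1)) := by
      calc q * ∑ v, f v = ∑ v, q * f v := Finset.mul_sum _ _ _
        _ ≤ ∑ v, (q - 1) * covW q (f v) := Finset.sum_le_sum fun v _ => covW_cost hq
        _ = (q - 1) * ∑ v, covW q (f v) := (Finset.mul_sum _ _ _).symm
        _ ≤ (q - 1) * n := Nat.mul_le_mul_left _ hsum
        _ = q * (m * (q - 1)) := by rw [hm]; ring
    exact Nat.le_of_mul_le_mul_left h3 (by omega)
  -- the extremal broadcast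
  classical
  have hlow : ∃ f, IsIndepBroadcast n a f ∧ m * (q - 1) = circCost n f := by
    refine ⟨fun v => if ZMod.castHom hqn (ZMod q) v = 0 then q - 1 else 0, ⟨?_, ?_⟩, ?_⟩
    · intro v
      have h1 : q - 1 ≤ circEcc n a v := by
        refine le_trans ?_ (hecc' v (v + ((q - 1 : ℕ) : ZMod n)))
        have := steps_cast hqn haq (hmem v (v + ((q - 1 : ℕ) : ZMod n)))
        rw [map_add, map_natCast] at this
        have := add_left_cancel this
        rw [ZMod.natCast_eq_natCast_iff', Nat.mod_eq_of_lt (by omega)] at this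
        exact this.le.trans (Nat.mod_le _ _)
      dsimp only
      split_ifs
      · exact h1
      · omega
    · intro u v huv hu hv
      dsimp only at hu hv ⊢
      split_ifs at hu hv ⊢ with h1 h2
      · have := steps_cast hqn haq (hmem u v)
        rw [h1, h2, zero_add] at this
        have := (ZMod.natCast_eq_zero_iff _ _).1 this.symm
        have hne : circDist n a u v ≠ 0 := by
          intro h0
          have h := hmem u v
          rw [h0] at h
          obtain ⟨g, e1, e2, _⟩ := h
          exact huv (e1.symm.trans e2)
        have := Nat.le_of_dvd (by omega) this
        omega
      all_goals omega
    · unfold circCost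
      simp only [map_natCast, ZMod.natCast_eq_zero_iff]
      rw [← Finset.sum_filter, Finset.sum_const, smul_eq_mul]
      congr 1
      rw [hm]
      have : (Finset.range (q * m)).filter (fun x => q ∣ x) = (Finset.range m).image (q * ·) := by
        ext x
        simp only [Finset.mem_filter, Finset.mem_range, Finset.mem_image]
        constructor
        · rintro ⟨hx, y, rfl⟩
          exact ⟨y, Nat.lt_of_mul_lt_mul_left hx, rfl⟩
        · rintro ⟨y, hy, rfl⟩
          exact ⟨Nat.mul_lt_mul_of_pos_left hy (by omega), y, rfl⟩
      rw [this, Finset.card_image_of_injective, Finset.card_range]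
      intro x y hxy
      exact Nat.eq_of_mul_eq_mul_left (show 0 < q by omega) hxy
  unfold betaB
  apply le_antisymm
  · obtain ⟨f, hf, he⟩ := hlow
    refine csSup_le ⟨_, f, hf, rfl⟩ ?_
    rintro c ⟨f, hf, rfl⟩
    exact hupper f hf
  · refine le_csSup ⟨m * (q - 1), ?_⟩ hlow
    rintro c ⟨f, hf, rfl⟩
    exact hupper f hf

end main

theorem stmt19 (n a q : ℕ) (hn : n = q * a + a - 1) (hq : 3 ≤ q) (ha : 4 ≤ a) :
    (∀ k : ℕ, 2 ≤ k → a = k * q + 1 → betaB n (a : ℤ) = (a + k) * (q - 1)) ∧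
    (∀ k : ℕ, 1 ≤ k → q = k * (a - 1) → betaB n (a : ℤ) = (q + k + 1) * (a - 2)) := by
  have hn1 : n + 1 = a * (q + 1) := by
    have : a * (q + 1) = q * a + a := by ring
    omega
  have hz : (a : ZMod n) * (q + 1 : ℕ) = 1 := by
    have : ((n + 1 : ℕ) : ZMod n) = ((a * (q + 1) : ℕ) : ZMod n) := by rw [hn1]
    rw [Nat.cast_mul] at this
    rw [← this]; simp
  constructor
  · intro k hk hak
    refine main_lemma (b := a) (q := q) (g := (a : ZMod n)) (h := 1) (g' := ((q + 1 : ℕ) : ZMod n))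
      hq (by omega) hn1 ?_ ?_ ?_ ?_ hz ?_
    · have : q * (a + k) + 1 = a * (q + 1) := by rw [hak]; ring
      omega
    · intro u; right; simp
    · intro u; left; rfl
    · rw [mul_comm]; exact hz.symm
    · rw [hak]; simp
  · intro k hk hqk
    obtain ⟨p, rfl⟩ : ∃ p, a = p + 1 := ⟨a - 1, by omega⟩
    rw [Nat.add_sub_cancel] at hqk
    have e : p + 1 - 2 = p - 1 := by omega
    rw [e]
    refine main_lemma (b := q + 1) (q := p) (g := (1 : ZMod n)) (h := ((p + 1 : ℕ) : ZMod n))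
      (g' := 1) (by omega) (by omega) (by rw [hn1]; ring) ?_ ?_ ?_ ?_ (by simp) ?_
    · have : p * (q + k + 1) + 1 = (p + 1) * (q + 1) := by rw [hqk]; ring
      omega
    · intro u; left; rfl
    · intro u; right; simp
    · simp
    · simp
end
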